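/- arXiv:2010.07633 — 7 statements merged into one kernel-verified Lean document; each statement's English description precedes it below -/
import Mathlib

section
/- Fix ε ∈ (0,1) and suppose the profits satisfy min_i p_i = 1 and every p_i is an integer power of (1+ε). Let S* be any solution with S*_T ≠ ∅, let ℓ_max = max{ℓ ∈ ℕ₀ : S*_T ∩ P_ℓ ≠ ∅}, and let L = ⌈log_{1+ε}(nρ/ε)⌉. Then there exists a prefix-like solution S̃ = ⟨S̃_1,…,S̃_T⟩ such that: (a) S̃ introduces only items from the profit classes P_ℓ with ℓ ∈ [max(ℓ_max − L + 1, 0), ℓ_max]; (b) w(S̃_t) ≤ w(S*_t) for every t ∈ [T], in particular w(S̃_T) ≤ w(S*_T); and (c) Ψ(S̃) ≥ (1−ε)·Ψ(S*). -/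
open Finset

/-- If every element of `B` weighs at most as much as every element of `A \ B`, and `A` and `B`
have the same cardinality, then `B` weighs at most as much as `A`. -/
theorem sum_le_sum_of_card_eq_of_forall_le {ι : Type*} [DecidableEq ι] {A B : Finset ι}
    (w : ι → ℝ) (hcard : B.card = A.card) (hle : ∀ i ∈ B, ∀ j ∈ A, j ∉ B → w i ≤ w j) :
    ∑ i ∈ B, w i ≤ ∑ i ∈ A, w i := by
  have hsdiff : (B \ A).card = (A \ B).card := Finset.card_sdiff_comm hcard
  suffices h : ∑ i ∈ B \ A, w i ≤ ∑ i ∈ A \ B, w i by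
    have hB := Finset.sum_inter_add_sum_sdiff B A w
    have hA := Finset.sum_inter_add_sum_sdiff A B w
    rw [Finset.inter_comm] at hA
    linarith
  rcases (B \ A).eq_empty_or_nonempty with hB | hB
  · have hA : A \ B = ∅ := by
      rw [← Finset.card_eq_zero, ← hsdiff, hB, Finset.card_empty]
    rw [hA, hB]
  · obtain ⟨m, hm, hmax⟩ := Finset.exists_max_image (B \ A) w hB
    calc ∑ i ∈ B \ A, w i ≤ (B \ A).card • w m := Finset.sum_le_card_nsmul _ _ _ hmax
      _ = (A \ B).card • w m := by rw [hsdiff]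
      _ ≤ ∑ i ∈ A \ B, w i := Finset.card_nsmul_le_sum _ _ _ fun j hj =>
          hle m (Finset.mem_sdiff.1 hm).1 j (Finset.mem_sdiff.1 hj).1 (Finset.mem_sdiff.1 hj).2

/-- If `x ≤ (1+ε)^L`, expressed through the logarithm, then a gap of at least `L` between the
exponents `k` and `m` absorbs a factor `x`. -/
theorem pow_mul_le_pow_of_logb_le {ε x : ℝ} (hε : 0 < ε) (hx : 0 < x) {L k m : ℕ}
    (hL : Real.logb (1 + ε) x ≤ L) (hk : k + L ≤ m) :
    (1 + ε) ^ k * x ≤ (1 + ε) ^ m := by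
  have hb : (1 : ℝ) < 1 + ε := by linarith
  have hxL : x ≤ (1 + ε) ^ L := by
    rw [Real.logb_le_iff_le_rpow hb hx, Real.rpow_natCast] at hL
    exact hL
  calc (1 + ε) ^ k * x ≤ (1 + ε) ^ k * (1 + ε) ^ L := by gcongr
    _ = (1 + ε) ^ (k + L) := (pow_add _ _ _).symm
    _ ≤ (1 + ε) ^ m := pow_le_pow_right₀ hb.le hk

/-- Existence of a near-optimal prefix-like solution supported on an
`O((1/ε)·log(nρ/ε))`-length interval of profit classes.  Profit classes are
`P ℓ = {i : p i = (1+ε)^ℓ}`; the family `Pre ℓ k` of the `k` smallest-weight items of `P ℓ`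
(with a fixed tie-breaking) is axiomatized by the hypotheses `hPreSub, hPreCard, hPreMono,
hPreMin`.  Given any solution `S*` with `S*_T ≠ ∅`, with `ℓmax` the largest index of a profit
class met by `S*_T` and `L = ⌈log_{1+ε}(nρ/ε)⌉`, there is a prefix-like solution `S̃` that
(a) uses only classes with indices in `[max(ℓmax − L + 1, 0), ℓmax]`,
(b) satisfies `w(S̃_t) ≤ w(S*_t)` for all `t`, and (c) has `Ψ(S̃) ≥ (1−ε)·Ψ(S*)`. -/
theorem stmt1
    (n T : ℕ) (hn : 1 ≤ n) (hT : 1 ≤ T)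
    (ε : ℝ) (hε0 : 0 < ε) (hε1 : ε < 1)
    (p w : Fin n → ℝ) (hw : ∀ i, 0 < w i)
    (Wcap lam : ℕ → ℝ)
    (hWmono : ∀ s t : ℕ, 1 ≤ s → s ≤ t → t ≤ T → Wcap s ≤ Wcap t)
    (hlam : ∀ t ∈ Finset.Icc 1 T, 0 ≤ lam t) (hlamT : 0 < lam T)
    -- profits: minimum equal to 1, every profit an integer power of (1+ε)
    (hpmin : ∀ i, 1 ≤ p i) (hpone : ∃ i, p i = 1)
    (hpow : ∀ i, ∃ k : ℤ, p i = (1 + ε) ^ k)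
    -- profit classes
    (P : ℕ → Finset (Fin n))
    (hP : ∀ (ℓ : ℕ) (i : Fin n), i ∈ P ℓ ↔ p i = (1 + ε) ^ ℓ)
    -- the k smallest-weight items of each class (fixed tie-breaking order)
    (Pre : ℕ → ℕ → Finset (Fin n))
    (hPreSub : ∀ ℓ k, Pre ℓ k ⊆ P ℓ)
    (hPreCard : ∀ ℓ k, k ≤ (P ℓ).card → (Pre ℓ k).card = k)
    (hPreMono : ∀ ℓ k k', k ≤ k' → Pre ℓ k ⊆ Pre ℓ k')
    (hPreMin : ∀ ℓ k, ∀ i ∈ Pre ℓ k, ∀ j ∈ P ℓ, j ∉ Pre ℓ k → w i ≤ w j)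
    -- an arbitrary solution S* with nonempty final set
    (Sstar : ℕ → Finset (Fin n))
    (hS0 : Sstar 0 = ∅)
    (hSmono : ∀ s t : ℕ, s ≤ t → t ≤ T → Sstar s ⊆ Sstar t)
    (hScap : ∀ t ∈ Finset.Icc 1 T, ∑ i ∈ Sstar t, w i ≤ Wcap t)
    (hSne : (Sstar T).Nonempty)
    -- the maximal index of a profit class met by S*_T
    (ℓmax : ℕ)
    (hℓmax : (Sstar T ∩ P ℓmax).Nonempty ∧ ∀ ℓ : ℕ, ℓmax < ℓ → Sstar T ∩ P ℓ = ∅)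
    -- ρ = λ^{1+}/λ^{T+} and L = ⌈log_{1+ε}(nρ/ε)⌉
    (ρ : ℝ) (hρ : ρ = (∑ τ ∈ Finset.Icc 1 T, lam τ) / lam T)
    (L : ℕ) (hL : (L : ℤ) = max ⌈Real.logb (1 + ε) (n * ρ / ε)⌉ 0) :
    ∃ St : ℕ → Finset (Fin n),
      St 0 = ∅ ∧
      (∀ s t : ℕ, s ≤ t → t ≤ T → St s ⊆ St t) ∧
      (∀ t ∈ Finset.Icc 1 T, ∑ i ∈ St t, w i ≤ Wcap t) ∧
      -- prefix-like
      (∀ t ∈ Finset.Icc 1 T, ∀ ℓ : ℕ, St t ∩ P ℓ = Pre ℓ ((St t ∩ P ℓ).card)) ∧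
      -- (a) only classes in the interval [max(ℓmax − L + 1, 0), ℓmax]
      (∀ i ∈ St T, ∃ ℓ ∈ Finset.Icc (ℓmax + 1 - L) ℓmax, i ∈ P ℓ) ∧
      -- (b) super-optimality of weights
      (∀ t ∈ Finset.Icc 1 T, ∑ i ∈ St t, w i ≤ ∑ i ∈ Sstar t, w i) ∧
      -- (c) ε-profit violation
      (1 - ε) * (∑ t ∈ Finset.Icc 1 T, lam t * ∑ i ∈ Sstar t, p i)
        ≤ ∑ t ∈ Finset.Icc 1 T, lam t * ∑ i ∈ St t, p i := by
  have hb : (1 : ℝ) < 1 + ε := by linarith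
  have hp0 : ∀ i, 0 ≤ p i := fun i => zero_le_one.trans (hpmin i)
  have hTmem : T ∈ Finset.Icc 1 T := Finset.mem_Icc.2 ⟨hT, le_rfl⟩
  have hPdisj : ∀ ℓ ℓ' : ℕ, ∀ i, i ∈ P ℓ → i ∈ P ℓ' → ℓ = ℓ' := by
    intro ℓ ℓ' i h h'
    rw [hP] at h h'
    exact pow_right_injective₀ (by linarith) hb.ne' (h.symm.trans h')
  have hclass : ∀ i, ∃ ℓ, i ∈ P ℓ := by
    intro i
    obtain ⟨k, hk⟩ := hpow i
    have hk0 : 0 ≤ k := by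
      rw [← one_le_zpow_iff_right₀ hb, ← hk]
      exact hpmin i
    lift k to ℕ using hk0
    exact ⟨k, (hP k i).2 (by rw [hk, zpow_natCast])⟩
  have hsumP : ∀ (I : Finset ℕ) (F : ℕ → Finset (Fin n)) (f : Fin n → ℝ), (∀ ℓ, F ℓ ⊆ P ℓ) →
      ∑ i ∈ I.biUnion F, f i = ∑ ℓ ∈ I, ∑ i ∈ F ℓ, f i := by
    intro I F f hF
    refine Finset.sum_biUnion fun ℓ _ ℓ' _ hne => ?_
    exact Finset.disjoint_left.2 fun i h h' => hne (hPdisj ℓ ℓ' i (hF ℓ h) (hF ℓ' h'))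
  have hcardle : ∀ t ℓ, (Sstar t ∩ P ℓ).card ≤ (P ℓ).card := fun t ℓ =>
    Finset.card_le_card Finset.inter_subset_right
  have hcard : ∀ t ℓ, (Pre ℓ (Sstar t ∩ P ℓ).card).card = (Sstar t ∩ P ℓ).card := fun t ℓ =>
    hPreCard ℓ _ (hcardle t ℓ)
  have hPre0 : ∀ ℓ, Pre ℓ 0 = ∅ := fun ℓ =>
    Finset.card_eq_zero.1 (hPreCard ℓ 0 (Nat.zero_le _))
  set I := Finset.Icc (ℓmax + 1 - L) ℓmax with hI
  set St : ℕ → Finset (Fin n) := fun t => I.biUnion fun ℓ => Pre ℓ (Sstar t ∩ P ℓ).card with hSt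
  set K : ℕ → Finset (Fin n) := fun t => I.biUnion fun ℓ => Sstar t ∩ P ℓ
  have hKsub : ∀ t, K t ⊆ Sstar t := fun t =>
    Finset.biUnion_subset.2 fun ℓ _ => Finset.inter_subset_left
  have hweight : ∀ t, ∑ i ∈ St t, w i ≤ ∑ i ∈ Sstar t, w i := by
    intro t
    calc ∑ i ∈ St t, w i = ∑ ℓ ∈ I, ∑ i ∈ Pre ℓ (Sstar t ∩ P ℓ).card, w i :=
          hsumP I _ w fun ℓ => hPreSub ℓ _
      _ ≤ ∑ ℓ ∈ I, ∑ i ∈ Sstar t ∩ P ℓ, w i := by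
          refine Finset.sum_le_sum fun ℓ _ => ?_
          refine sum_le_sum_of_card_eq_of_forall_le w (hcard t ℓ) fun i hi j hj hj' => ?_
          exact hPreMin ℓ _ i hi j (Finset.mem_inter.1 hj).2 hj'
      _ = ∑ i ∈ K t, w i := (hsumP I _ w fun ℓ => Finset.inter_subset_right).symm
      _ ≤ ∑ i ∈ Sstar t, w i :=
          Finset.sum_le_sum_of_subset_of_nonneg (hKsub t) fun i _ _ => (hw i).le
  have hclassSum : ∀ (ℓ : ℕ) (A : Finset (Fin n)), A ⊆ P ℓ →
      ∑ i ∈ A, p i = A.card • (1 + ε) ^ ℓ := fun ℓ A hA =>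
    Finset.sum_eq_card_nsmul fun i hi => (hP ℓ i).1 (hA hi)
  have hprofit : ∀ t, ∑ i ∈ St t, p i = ∑ i ∈ K t, p i := by
    intro t
    rw [hsumP I _ p fun ℓ => hPreSub ℓ _, hsumP I _ p fun ℓ => Finset.inter_subset_right]
    refine Finset.sum_congr rfl fun ℓ _ => ?_
    rw [hclassSum ℓ _ (hPreSub ℓ _), hclassSum ℓ _ Finset.inter_subset_right, hcard]
  set Λ := ∑ τ ∈ Finset.Icc 1 T, lam τ with hΛ
  have hΛT : lam T ≤ Λ := Finset.single_le_sum hlam hTmem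
  have hn0 : (0 : ℝ) < n := by exact_mod_cast hn
  have hΛ0 : 0 < Λ := hlamT.trans_le hΛT
  have hρ0 : 0 < ρ := by rw [hρ]; positivity
  have hx : 0 < n * ρ / ε := by positivity
  have hlogL : Real.logb (1 + ε) (n * ρ / ε) ≤ L := by
    have h : ⌈Real.logb (1 + ε) (n * ρ / ε)⌉ ≤ (L : ℤ) := hL ▸ le_max_left _ _
    exact_mod_cast Int.ceil_le.1 h
  set δ := (1 + ε) ^ ℓmax / (n * ρ / ε) with hδ
  have hδ0 : 0 ≤ δ := by positivity
  have hdropped : ∀ t ≤ T, ∀ i ∈ Sstar t \ K t, p i ≤ δ := by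
    intro t ht i hi
    obtain ⟨hiS, hiK⟩ := Finset.mem_sdiff.1 hi
    obtain ⟨k, hk⟩ := hclass i
    have hkle : k ≤ ℓmax := by
      by_contra! hlt
      have := hℓmax.2 k hlt
      have hmem := Finset.mem_inter.2 ⟨hSmono t T ht le_rfl hiS, hk⟩
      simp [this] at hmem
    have hkI : k ∉ I := fun h =>
      hiK (Finset.mem_biUnion.2 ⟨k, h, Finset.mem_inter.2 ⟨hiS, hk⟩⟩)
    rw [hI, Finset.mem_Icc] at hkI
    rw [hδ, le_div_iff₀ hx, (hP k i).1 hk]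
    exact pow_mul_le_pow_of_logb_le hε0 hx hlogL (by omega)
  have hloss : ∀ t ≤ T, ∑ i ∈ Sstar t, p i ≤ ∑ i ∈ St t, p i + n * δ := by
    intro t ht
    rw [hprofit, ← Finset.sum_sdiff (hKsub t), add_comm]
    gcongr
    calc ∑ i ∈ Sstar t \ K t, p i ≤ (Sstar t \ K t).card • δ :=
          Finset.sum_le_card_nsmul _ _ _ (hdropped t ht)
      _ ≤ n * δ := by
          rw [nsmul_eq_mul]
          gcongr
          simpa using Finset.card_le_univ (Sstar t \ K t)
  refine ⟨St, ?_, ?_, ?_, ?_, ?_, ?_, ?_⟩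
  · exact Finset.subset_empty.1 (Finset.biUnion_subset.2 fun ℓ _ => by simp [hS0, hPre0])
  · intro s t hst ht
    refine Finset.biUnion_mono fun ℓ _ => hPreMono ℓ _ _ (Finset.card_le_card ?_)
    exact Finset.inter_subset_inter_right (hSmono s t hst ht)
  · exact fun t ht => (hweight t).trans (hScap t ht)
  · intro t _ ℓ
    by_cases hℓ : ℓ ∈ I
    · have h : St t ∩ P ℓ = Pre ℓ (Sstar t ∩ P ℓ).card := by
        ext i
        simp only [hSt, Finset.mem_inter, Finset.mem_biUnion]
        constructor
        · rintro ⟨⟨ℓ', _, hi⟩, hiP⟩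
          obtain rfl := hPdisj ℓ ℓ' i hiP (hPreSub _ _ hi)
          exact hi
        · exact fun hi => ⟨⟨ℓ, hℓ, hi⟩, hPreSub _ _ hi⟩
      rw [h, hcard]
    · have h : St t ∩ P ℓ = ∅ := by
        refine Finset.eq_empty_of_forall_notMem fun i hi => ?_
        obtain ⟨hiS, hiP⟩ := Finset.mem_inter.1 hi
        obtain ⟨ℓ', hℓ', hi'⟩ := Finset.mem_biUnion.1 hiS
        obtain rfl := hPdisj ℓ ℓ' i hiP (hPreSub _ _ hi')
        exact hℓ hℓ'
      rw [h, Finset.card_empty, hPre0]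
  · intro i hi
    obtain ⟨ℓ, hℓ, hi'⟩ := Finset.mem_biUnion.1 hi
    exact ⟨ℓ, hℓ, hPreSub _ _ hi'⟩
  · exact fun t _ => hweight t
  · have htotal : ∑ t ∈ Finset.Icc 1 T, lam t * ∑ i ∈ Sstar t, p i
        ≤ ∑ t ∈ Finset.Icc 1 T, lam t * ∑ i ∈ St t, p i + Λ * (n * δ) := by
      rw [hΛ, Finset.sum_mul, ← Finset.sum_add_distrib]
      refine Finset.sum_le_sum fun t ht => ?_
      rw [← mul_add]
      exact mul_le_mul_of_nonneg_left (hloss t (Finset.mem_Icc.1 ht).2) (hlam t ht)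
    have hlossTotal : Λ * (n * δ) = ε * (lam T * (1 + ε) ^ ℓmax) := by
      rw [hδ, hρ]
      field_simp
    have htop : lam T * (1 + ε) ^ ℓmax ≤ ∑ t ∈ Finset.Icc 1 T, lam t * ∑ i ∈ Sstar t, p i := by
      obtain ⟨i, hi⟩ := hℓmax.1
      obtain ⟨hiS, hiP⟩ := Finset.mem_inter.1 hi
      calc lam T * (1 + ε) ^ ℓmax = lam T * p i := by rw [(hP ℓmax i).1 hiP]
        _ ≤ lam T * ∑ i ∈ Sstar T, p i :=
            mul_le_mul_of_nonneg_left (Finset.single_le_sum (fun j _ => hp0 j) hiS) hlamT.le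
        _ ≤ _ := Finset.single_le_sum (f := fun t => lam t * ∑ i ∈ Sstar t, p i)
            (fun t ht => mul_nonneg (hlam t ht) (Finset.sum_nonneg fun j _ => hp0 j)) hTmem
    have := mul_le_mul_of_nonneg_left htop hε0.le
    linarith
end

section
/- The up-rounding operation is monotone: if N and N⁺ are utilization vectors with N ≤ N⁺ componentwise, then N^(1) ≤ N^{+(1)} componentwise. -/
open Finset
open scoped Classical

noncomputable section

namespace IK

variable {ι : Type*} [Fintype ι]

/-- `Wcl wgt ℓ a b = Σ_{j=a}^{b} w_{ℓ,j}`, the total weight of items `a,…,b` of class `ℓ`. -/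
def Wcl (wgt : ι → ℕ → ℝ) (ℓ : ι) (a b : ℕ) : ℝ := ∑ j ∈ Finset.Icc a b, wgt ℓ j

/-- The set `H(N)` of classes that are heavy for `N` (here `e = 1/ε`). -/
def heavy (e : ℕ) (N : ι → ℕ) : Finset ι := Finset.univ.filter fun ℓ => e < N ℓ

/-- `W_H(N)`, the weight picked by `N` from heavy classes beyond their first `1/ε` items. -/
def WH (wgt : ι → ℕ → ℝ) (e : ℕ) (N : ι → ℕ) : ℝ :=
  ∑ ℓ ∈ heavy e N, Wcl wgt ℓ (e + 1) (N ℓ)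

/-- `P2[x]`: the least integer power of `2` that is `≥ x` for `x > 0`, and `0` for `x ≤ 0`. -/
def P2 (x : ℝ) : ℝ := if 0 < x then (2 : ℝ) ^ ⌈Real.logb 2 x⌉ else 0

/-- The rounding unit `P2[(ε/|L|)·W_H(N)]`. -/
def base (ε : ℝ) (wgt : ι → ℕ → ℝ) (e : ℕ) (N : ι → ℕ) : ℝ :=
  P2 (ε / (Fintype.card ι) * WH wgt e N)

/-- The multiplier `μ_ℓ(N)`: the unique integer with
`(μ_ℓ(N)−1)·P2[(ε/|L|)·W_H(N)] < W_ℓ(1/ε+1, N_ℓ) ≤ μ_ℓ(N)·P2[(ε/|L|)·W_H(N)]`. -/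
def mu (ε : ℝ) (wgt : ι → ℕ → ℝ) (e : ℕ) (N : ι → ℕ) (ℓ : ι) : ℤ :=
  ⌈Wcl wgt ℓ (e + 1) (N ℓ) / base ε wgt e N⌉

/-- The over-estimate `E_ℓ(N) = μ_ℓ(N)·P2[(ε/|L|)·W_H(N)]`. -/
def Ecl (ε : ℝ) (wgt : ι → ℕ → ℝ) (e : ℕ) (N : ι → ℕ) (ℓ : ι) : ℝ :=
  (mu ε wgt e N ℓ : ℝ) * base ε wgt e N

/-- The up-rounding `N^(1)` of `N`: coordinates of light classes are kept, while each heavy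
class picks `max{k ∈ [1/ε+1, n_ℓ] : W_ℓ(1/ε+1, k) ≤ E_ℓ(N)}` items. -/
def upround (ε : ℝ) (wgt : ι → ℕ → ℝ) (nI : ι → ℕ) (e : ℕ) (N : ι → ℕ) : ι → ℕ :=
  fun ℓ =>
    if e < N ℓ then
      ((Finset.Icc (e + 1) (nI ℓ)).filter fun k => Wcl wgt ℓ (e + 1) k ≤ Ecl ε wgt e N ℓ).sup id
    else N ℓ

/-- `Δ_ℓ(N) = N^(1)_ℓ − 1/ε`. -/
def delta (ε : ℝ) (wgt : ι → ℕ → ℝ) (nI : ι → ℕ) (e : ℕ) (N : ι → ℕ) (ℓ : ι) : ℕ :=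
  upround ε wgt nI e N ℓ - e

/-- The truncation `N^(2)` of `N`: coordinates of light classes are kept, while each heavy
class eliminates its last `⌈2ε·Δ_ℓ(N)⌉` items from `N^(1)`. -/
def trunc (ε : ℝ) (wgt : ι → ℕ → ℝ) (nI : ι → ℕ) (e : ℕ) (N : ι → ℕ) : ι → ℕ :=
  fun ℓ =>
    if e < N ℓ then
      upround ε wgt nI e N ℓ - (⌈2 * ε * (delta ε wgt nI e N ℓ : ℝ)⌉).toNat
    else upround ε wgt nI e N ℓ

/-- The total weight `w(N) = Σ_ℓ W_ℓ(1, N_ℓ)` of a utilization vector. -/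
def wtot (wgt : ι → ℕ → ℝ) (N : ι → ℕ) : ℝ := ∑ ℓ : ι, Wcl wgt ℓ 1 (N ℓ)

end IK

namespace IK

/-- `P2` of a larger positive number is an integer multiple of `P2` of a smaller one. -/
theorem exists_nat_mul_P2 {x y : ℝ} (hx : 0 < x) (hxy : x ≤ y) :
    ∃ m : ℕ, P2 y = m * P2 x := by
  have hlog : ⌈Real.logb 2 x⌉ ≤ ⌈Real.logb 2 y⌉ :=
    Int.ceil_le_ceil (Real.logb_le_logb_of_le one_lt_two hx hxy)
  obtain ⟨k, hk⟩ := Int.le.dest hlog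
  refine ⟨2 ^ k, ?_⟩
  rw [P2, P2, if_pos hx, if_pos (hx.trans_le hxy), ← hk, zpow_add₀ two_ne_zero, zpow_natCast]
  push_cast
  ring

theorem P2_pos {x : ℝ} (hx : 0 < x) : 0 < P2 x := by
  rw [P2, if_pos hx]
  positivity

theorem le_ceil_div_mul (x : ℝ) {b : ℝ} (hb : 0 < b) : x ≤ (⌈x / b⌉ : ℝ) * b :=
  (div_le_iff₀ hb).1 (Int.le_ceil _)

/-- Rounding up to a multiple of `b` is monotone in the argument and in `b` under divisibility. -/
theorem ceil_div_mul_le_ceil_div_mul {x y b c : ℝ} (hb : 0 < b) (hc : 0 < c) (hxy : x ≤ y)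
    {m : ℕ} (hm : c = m * b) : (⌈x / b⌉ : ℝ) * b ≤ (⌈y / c⌉ : ℝ) * c := by
  have h : ⌈x / b⌉ ≤ ⌈y / c⌉ * m := by
    rw [Int.ceil_le, div_le_iff₀ hb]
    push_cast
    rw [mul_assoc, ← hm]
    exact hxy.trans (le_ceil_div_mul y hc)
  calc (⌈x / b⌉ : ℝ) * b ≤ ((⌈y / c⌉ * m : ℤ) : ℝ) * b := by gcongr
    _ = (⌈y / c⌉ : ℝ) * c := by rw [hm]; push_cast; ring

section Weights

variable {ι : Type*} {nI : ι → ℕ} {wgt : ι → ℕ → ℝ}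

theorem Wcl_nonneg (hw0 : ∀ ℓ, ∀ j ∈ Finset.Icc 1 (nI ℓ), 0 < wgt ℓ j) (ℓ : ι) (a : ℕ)
    {k : ℕ} (hk : k ≤ nI ℓ) : 0 ≤ Wcl wgt ℓ (a + 1) k :=
  Finset.sum_nonneg fun j hj =>
    (hw0 ℓ j (by simp only [Finset.mem_Icc] at hj ⊢; omega)).le

theorem Wcl_pos (hw0 : ∀ ℓ, ∀ j ∈ Finset.Icc 1 (nI ℓ), 0 < wgt ℓ j) {ℓ : ι} {a k : ℕ}
    (hak : a < k) (hk : k ≤ nI ℓ) : 0 < Wcl wgt ℓ (a + 1) k :=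
  Finset.sum_pos (fun j hj => hw0 ℓ j (by simp only [Finset.mem_Icc] at hj ⊢; omega))
    (Finset.nonempty_Icc.2 hak)

theorem Wcl_mono (hw0 : ∀ ℓ, ∀ j ∈ Finset.Icc 1 (nI ℓ), 0 < wgt ℓ j) (ℓ : ι) (a : ℕ)
    {k k' : ℕ} (hkk' : k ≤ k') (hk' : k' ≤ nI ℓ) :
    Wcl wgt ℓ (a + 1) k ≤ Wcl wgt ℓ (a + 1) k' :=
  Finset.sum_le_sum_of_subset_of_nonneg (Finset.Icc_subset_Icc_right hkk') fun j hj _ =>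
    (hw0 ℓ j (by simp only [Finset.mem_Icc] at hj ⊢; omega)).le

variable [Fintype ι]

theorem WH_pos (hw0 : ∀ ℓ, ∀ j ∈ Finset.Icc 1 (nI ℓ), 0 < wgt ℓ j) {e : ℕ} {N : ι → ℕ}
    (hN : ∀ ℓ, N ℓ ≤ nI ℓ) {ℓ : ι} (hℓ : e < N ℓ) : 0 < WH wgt e N :=
  Finset.sum_pos (fun i hi => Wcl_pos hw0 (by simpa [heavy] using hi) (hN i))
    ⟨ℓ, by simpa [heavy] using hℓ⟩

theorem WH_mono (hw0 : ∀ ℓ, ∀ j ∈ Finset.Icc 1 (nI ℓ), 0 < wgt ℓ j) (e : ℕ) {N Np : ι → ℕ}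
    (hNp : ∀ ℓ, Np ℓ ≤ nI ℓ) (hle : ∀ ℓ, N ℓ ≤ Np ℓ) : WH wgt e N ≤ WH wgt e Np := by
  have hsub : heavy e N ⊆ heavy e Np := fun i hi => by
    simp only [heavy, Finset.mem_filter, Finset.mem_univ, true_and] at hi ⊢
    exact hi.trans_le (hle i)
  exact (Finset.sum_le_sum fun i _ => Wcl_mono hw0 i e (hle i) (hNp i)).trans
    (Finset.sum_le_sum_of_subset_of_nonneg hsub fun i _ _ => Wcl_nonneg hw0 i e (hNp i))

variable [Nonempty ι]

theorem unit_arg_pos (hw0 : ∀ ℓ, ∀ j ∈ Finset.Icc 1 (nI ℓ), 0 < wgt ℓ j) {ε : ℝ} (hε : 0 < ε)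
    {e : ℕ} {N : ι → ℕ} (hN : ∀ ℓ, N ℓ ≤ nI ℓ) {ℓ : ι} (hℓ : e < N ℓ) :
    0 < ε / (Fintype.card ι) * WH wgt e N := by
  have := WH_pos hw0 hN hℓ
  have : 0 < Fintype.card ι := Fintype.card_pos
  positivity

/-- Up-rounding never decreases a coordinate. -/
theorem le_upround (hw0 : ∀ ℓ, ∀ j ∈ Finset.Icc 1 (nI ℓ), 0 < wgt ℓ j) {ε : ℝ} (hε : 0 < ε)
    (e : ℕ) {N : ι → ℕ} (hN : ∀ ℓ, N ℓ ≤ nI ℓ) (ℓ : ι) : N ℓ ≤ upround ε wgt nI e N ℓ := by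
  unfold upround
  split_ifs with hℓ
  · refine Finset.le_sup (f := id) (Finset.mem_filter.2 ⟨Finset.mem_Icc.2 ⟨hℓ, hN ℓ⟩, ?_⟩)
    exact le_ceil_div_mul _ (P2_pos (unit_arg_pos hw0 hε hN hℓ))
  · exact le_rfl

theorem Ecl_mono (hw0 : ∀ ℓ, ∀ j ∈ Finset.Icc 1 (nI ℓ), 0 < wgt ℓ j) {ε : ℝ} (hε : 0 < ε)
    {e : ℕ} {N Np : ι → ℕ} (hNp : ∀ ℓ, Np ℓ ≤ nI ℓ) (hle : ∀ ℓ, N ℓ ≤ Np ℓ) {ℓ : ι}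
    (hℓ : e < N ℓ) : Ecl ε wgt e N ℓ ≤ Ecl ε wgt e Np ℓ := by
  have hpos := unit_arg_pos hw0 hε (fun i => (hle i).trans (hNp i)) hℓ
  have hpos' := unit_arg_pos hw0 hε hNp (hℓ.trans_le (hle ℓ))
  obtain ⟨m, hm⟩ := exists_nat_mul_P2 hpos
    (mul_le_mul_of_nonneg_left (WH_mono hw0 e hNp hle) (by positivity))
  exact ceil_div_mul_le_ceil_div_mul (P2_pos hpos) (P2_pos hpos')
    (Wcl_mono hw0 ℓ e (hle ℓ) (hNp ℓ)) hm

end Weights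

end IK

/-- The up-rounding operation is monotone: if `N ≤ N⁺` componentwise then
`N^(1) ≤ N^{+(1)}` componentwise. -/
theorem stmt3 {ι : Type*} [Fintype ι] [Nonempty ι]
    (ε : ℝ) (e : ℕ) (hε0 : 0 < ε) (hε : ε < 1 / 4) (he : (e : ℝ) * ε = 1)
    (nI : ι → ℕ) (wgt : ι → ℕ → ℝ)
    (hw0 : ∀ ℓ, ∀ j ∈ Finset.Icc 1 (nI ℓ), 0 < wgt ℓ j)
    (hwm : ∀ ℓ, ∀ j k : ℕ, 1 ≤ j → j ≤ k → k ≤ nI ℓ → wgt ℓ j ≤ wgt ℓ k)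
    (N Np : ι → ℕ) (hN : ∀ ℓ, N ℓ ≤ nI ℓ) (hNp : ∀ ℓ, Np ℓ ≤ nI ℓ)
    (hle : ∀ ℓ, N ℓ ≤ Np ℓ) :
    ∀ ℓ, IK.upround ε wgt nI e N ℓ ≤ IK.upround ε wgt nI e Np ℓ := by
  intro ℓ
  by_cases hℓ : e < N ℓ
  · unfold IK.upround
    rw [if_pos hℓ, if_pos (hℓ.trans_le (hle ℓ))]
    exact Finset.sup_mono (Finset.monotone_filter_right _ fun k _ hk =>
      hk.trans (IK.Ecl_mono hw0 hε0 hNp hle hℓ))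
  · calc IK.upround ε wgt nI e N ℓ = N ℓ := if_neg hℓ
      _ ≤ Np ℓ := hle ℓ
      _ ≤ IK.upround ε wgt nI e Np ℓ := IK.le_upround hw0 hε0 e hNp ℓ
end
end

section
/- For every utilization vector N, the multipliers of its heavy classes satisfy Σ_{ℓ∈H(N)} μ_ℓ(N) ≤ (3/2)·|L|/ε. -/
open Finset
open scoped Classical

noncomputable section

namespace IK

lemma P2_of_nonpos {x : ℝ} (hx : x ≤ 0) : P2 x = 0 := if_neg hx.not_gt

lemma le_P2 {x : ℝ} (hx : 0 < x) : x ≤ P2 x := by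
  rw [P2, if_pos hx, ← Real.rpow_intCast]
  calc x = (2 : ℝ) ^ Real.logb 2 x := (Real.rpow_logb (by norm_num) (by norm_num) hx).symm
    _ ≤ (2 : ℝ) ^ ((⌈Real.logb 2 x⌉ : ℤ) : ℝ) :=
      Real.rpow_le_rpow_of_exponent_le (by norm_num) (Int.le_ceil _)

lemma div_P2_mul_le {c x : ℝ} (hc : 0 < c) : x / P2 (c * x) ≤ 1 / c := by
  rcases le_or_gt x 0 with hx | hx
  · rw [P2_of_nonpos (mul_nonpos_of_nonneg_of_nonpos hc.le hx), div_zero]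
    positivity
  · have hcx := mul_pos hc hx
    have hle := le_P2 hcx
    rw [div_le_div_iff₀ (hcx.trans_le hle) hc]
    linarith

/-- The multipliers sum to at most `|L| + |L|/ε`: rounding up costs at most one per class. -/
lemma sum_mu_le {ι : Type*} [Fintype ι] [Nonempty ι] {ε : ℝ} (hε : 0 < ε)
    (wgt : ι → ℕ → ℝ) (e : ℕ) (N : ι → ℕ) :
    ((∑ ℓ ∈ heavy e N, mu ε wgt e N ℓ : ℤ) : ℝ) ≤ Fintype.card ι + Fintype.card ι / ε := by
  have hL : (0 : ℝ) < Fintype.card ι := Nat.cast_pos.mpr Fintype.card_pos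
  push_cast
  calc ∑ ℓ ∈ heavy e N, (mu ε wgt e N ℓ : ℝ)
      ≤ ∑ ℓ ∈ heavy e N, (1 + Wcl wgt ℓ (e + 1) (N ℓ) / base ε wgt e N) :=
        Finset.sum_le_sum fun ℓ _ => by
          rw [add_comm]
          exact (Int.ceil_lt_add_one _).le
    _ = (heavy e N).card + WH wgt e N / base ε wgt e N := by
        rw [Finset.sum_add_distrib, ← Finset.sum_div, WH]
        simp
    _ ≤ Fintype.card ι + Fintype.card ι / ε := by
        refine add_le_add (Nat.cast_le.mpr (Finset.card_le_univ _)) ?_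
        simpa only [base, one_div_div] using
          div_P2_mul_le (x := WH wgt e N) (div_pos hε hL)

end IK

/-- For every utilization vector `N`, the multipliers of its heavy classes
satisfy `Σ_{ℓ∈H(N)} μ_ℓ(N) ≤ (3/2)·|L|/ε`. -/
theorem stmt9 {ι : Type*} [Fintype ι] [Nonempty ι]
    (ε : ℝ) (e : ℕ) (hε0 : 0 < ε) (hε : ε < 1 / 4) (he : (e : ℝ) * ε = 1)
    (nI : ι → ℕ) (wgt : ι → ℕ → ℝ)
    (hw0 : ∀ ℓ, ∀ j ∈ Finset.Icc 1 (nI ℓ), 0 < wgt ℓ j)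
    (hwm : ∀ ℓ, ∀ j k : ℕ, 1 ≤ j → j ≤ k → k ≤ nI ℓ → wgt ℓ j ≤ wgt ℓ k)
    (N : ι → ℕ) (hN : ∀ ℓ, N ℓ ≤ nI ℓ) :
    ((∑ ℓ ∈ IK.heavy e N, IK.mu ε wgt e N ℓ : ℤ) : ℝ)
      ≤ 3 / 2 * (Fintype.card ι : ℝ) / ε := by
  refine (IK.sum_mu_le hε0 wgt e N).trans ?_
  rw [le_div_iff₀ hε0, add_mul, div_mul_cancel₀ _ hε0.ne']
  nlinarith [(Nat.cast_nonneg (Fintype.card ι) : (0 : ℝ) ≤ Fintype.card ι)]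
end
end

section
/- Fix ε ∈ (0,1) with 1/ε ∈ ℕ. For t ∈ [T], let m(t) ≥ 1 be the unique positive integer with λ^{t+} ∈ ((ε/n)^{m(t)} · λ^{1+}, (ε/n)^{m(t)−1} · λ^{1+}]. For ξ ∈ {0, 1, …, 1/ε − 1}, call period t bad for ξ if m(t) ≡ ξ (mod 1/ε) and good for ξ otherwise. Given any solution S*, let S_ξ be the sequence that introduces, at each period t that is good for ξ, exactly the items S*_t ∖ S*_{t−1}, and introduces nothing at bad periods (so items introduced by S* at bad periods are deleted from all subsequent sets). Then each S_ξ is a feasible solution, and the expectation over ξ drawn uniformly from {0, …, 1/ε − 1} satisfies E_ξ[Ψ(S_ξ)] = (1 − ε)·Ψ(S*); equivalently, ε · Σ_{ξ=0}^{1/ε − 1} Ψ(S_ξ) = (1 − ε)·Ψ(S*). -/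
open Finset

noncomputable section

/-- The profit `Ψ(S) = Σ_{t∈[T]} λ_t · p(S_t)` of a sequence of item sets. -/
def Psi11 {n : ℕ} (T : ℕ) (lam : ℕ → ℝ) (p : Fin n → ℝ) (S : ℕ → Finset (Fin n)) : ℝ :=
  ∑ t ∈ Finset.Icc 1 T, lam t * ∑ i ∈ S t, p i

/-- Deleting from `S` each residue class of `r` in turn loses every item exactly once. -/
theorem sum_Psi11_filter_ne {n : ℕ} (T : ℕ) (lam : ℕ → ℝ) (p : Fin n → ℝ)
    (S : ℕ → Finset (Fin n)) (r : Fin n → ℕ) (e : ℕ) (hr : ∀ i, r i < e) :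
    ∑ ξ ∈ Finset.range e, Psi11 T lam p (fun t => (S t).filter fun i => ¬ r i = ξ)
      = ((e : ℝ) - 1) * Psi11 T lam p S := by
  unfold Psi11
  rw [Finset.sum_comm, Finset.mul_sum]
  refine Finset.sum_congr rfl fun t _ => ?_
  rw [← Finset.mul_sum, mul_left_comm]
  congr 1
  simp only [Finset.sum_filter]
  rw [Finset.sum_comm, Finset.mul_sum]
  refine Finset.sum_congr rfl fun i _ => ?_
  have h : ∀ ξ, (if ¬ r i = ξ then p i else 0) = p i - if r i = ξ then p i else 0 := by
    intro ξ
    split_ifs <;> simp_all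
  simp only [h, Finset.sum_sub_distrib, Finset.sum_const, Finset.card_range, nsmul_eq_mul,
    Finset.sum_ite_eq, Finset.mem_range, hr i, if_true]
  ring

/-- Clustering of time periods: with `m(t)` the unique positive integer such
that `λ^{t+} ∈ ((ε/n)^{m(t)}·λ^{1+}, (ε/n)^{m(t)−1}·λ^{1+}]`, a period `t` is bad for
`ξ ∈ {0,…,1/ε−1}` if `m(t) ≡ ξ (mod 1/ε)`.  Given any solution `S*` (with introduction
periods `ν`), the solution `S_ξ` keeps exactly the items of `S*` introduced at periods that
are good for `ξ`.  Then every `S_ξ` is a feasible solution, and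
`ε · Σ_{ξ=0}^{1/ε−1} Ψ(S_ξ) = (1−ε)·Ψ(S*)`, i.e. `E_ξ[Ψ(S_ξ)] = (1−ε)·Ψ(S*)`. -/
theorem stmt11
    (n T : ℕ) (hn : 1 ≤ n) (hT : 1 ≤ T)
    (ε : ℝ) (e : ℕ) (hε0 : 0 < ε) (hε1 : ε < 1) (he : (e : ℝ) * ε = 1)
    (p w : Fin n → ℝ) (hp : ∀ i, 0 < p i) (hw : ∀ i, 0 < w i)
    (Wcap lam : ℕ → ℝ)
    (hWmono : ∀ s t : ℕ, 1 ≤ s → s ≤ t → t ≤ T → Wcap s ≤ Wcap t)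
    (hlam : ∀ t ∈ Finset.Icc 1 T, 0 ≤ lam t) (hlamT : 0 < lam T)
    -- the interval index m(t)
    (m : ℕ → ℕ)
    (hm : ∀ t ∈ Finset.Icc 1 T, 1 ≤ m t ∧
        (ε / n) ^ m t * (∑ τ ∈ Finset.Icc 1 T, lam τ) < ∑ τ ∈ Finset.Icc t T, lam τ ∧
        ∑ τ ∈ Finset.Icc t T, lam τ ≤ (ε / n) ^ (m t - 1) * (∑ τ ∈ Finset.Icc 1 T, lam τ))
    -- the solution S* together with its introduction periods ν
    (Sstar : ℕ → Finset (Fin n))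
    (hS0 : Sstar 0 = ∅)
    (hSmono : ∀ s t : ℕ, s ≤ t → t ≤ T → Sstar s ⊆ Sstar t)
    (hScap : ∀ t ∈ Finset.Icc 1 T, ∑ i ∈ Sstar t, w i ≤ Wcap t)
    (ν : Fin n → ℕ)
    (hν : ∀ i ∈ Sstar T, ν i ∈ Finset.Icc 1 T ∧ i ∈ Sstar (ν i) ∧ i ∉ Sstar (ν i - 1))
    -- the solutions S_ξ: keep exactly the items introduced at good periods
    (Sxi : ℕ → ℕ → Finset (Fin n))
    (hSxi : ∀ ξ t, Sxi ξ t = (Sstar t).filter fun i => ¬ m (ν i) % e = ξ) :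
    (∀ ξ : ℕ,
        Sxi ξ 0 = ∅ ∧
        (∀ s t : ℕ, s ≤ t → t ≤ T → Sxi ξ s ⊆ Sxi ξ t) ∧
        ∀ t ∈ Finset.Icc 1 T, ∑ i ∈ Sxi ξ t, w i ≤ Wcap t) ∧
      ε * ∑ ξ ∈ Finset.range e, Psi11 T lam p (Sxi ξ)
        = (1 - ε) * Psi11 T lam p Sstar := by
  have he0 : 0 < e := by
    rcases Nat.eq_zero_or_pos e with h | h
    · simp [h] at he
    · exact h
  refine ⟨fun ξ => ⟨?_, ?_, ?_⟩, ?_⟩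
  · simp [hSxi, hS0]
  · intro s t hst ht
    rw [hSxi, hSxi]
    exact Finset.filter_subset_filter _ (hSmono s t hst ht)
  · intro t ht
    rw [hSxi]
    exact (Finset.sum_le_sum_of_subset_of_nonneg (Finset.filter_subset _ _)
      fun i _ _ => (hw i).le).trans (hScap t ht)
  · have hfun : ∀ ξ, Sxi ξ = fun t => (Sstar t).filter fun i => ¬ m (ν i) % e = ξ :=
      fun ξ => funext (hSxi ξ)
    simp only [hfun]
    rw [sum_Psi11_filter_ne T lam p Sstar (fun i => m (ν i) % e) e fun i => Nat.mod_lt _ he0,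
      ← mul_assoc]
    congr 1
    linarith
end
end

section
/- Fix ε ∈ (0,1), and suppose every profit is of the form p_i = (1+ε)^{ℓ(i)} with ℓ(i) ∈ ℕ₀, with profit classes P_ℓ = {i : p_i = (1+ε)^ℓ}. Let C_1, …, C_M ⊆ [T] be pairwise disjoint sets of periods such that for all m < m', every period of C_m precedes every period of C_{m'} and λ^{(min C_{m'})+} ≤ (ε/n) · λ^{(max C_m)+}. Let S be a solution that introduces items only at periods belonging to C_1 ∪ ⋯ ∪ C_M and such that Ψ_i(S) > (ε/n)·Ψ(S) for every i ∈ S_T. Then the bipartite graph G(S), whose vertices are the clusters C_1,…,C_M and the profit classes, with an edge (C_m, P_ℓ) whenever at least one item of P_ℓ is introduced by S at a period of C_m, is a collection of uncrossing stars: (1) each vertex P_ℓ has degree at most 1, i.e., all items of P_ℓ introduced by S are introduced at periods of a single cluster; and (2) there are no crossing edges, i.e., no pair of edges (C_{m1}, P_{ℓ1}) and (C_{m2}, P_{ℓ2}) with ℓ1 < ℓ2 and m1 > m2. -/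
open Finset

noncomputable section

/-- The profit `Ψ(S) = Σ_{t∈[T]} λ_t · p(S_t)` of a sequence of item sets. -/
def Psi12 {n : ℕ} (T : ℕ) (lam : ℕ → ℝ) (p : Fin n → ℝ) (S : ℕ → Finset (Fin n)) : ℝ :=
  ∑ t ∈ Finset.Icc 1 T, lam t * ∑ i ∈ S t, p i

/-- The contribution `Ψ_i(S)` of a single item is at most the total profit `Ψ(S)`. -/
theorem item_contribution_le_Psi12 {n T : ℕ} {lam : ℕ → ℝ} {p : Fin n → ℝ}
    {S : ℕ → Finset (Fin n)} (hp : ∀ i, 0 ≤ p i)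
    (hlam : ∀ t ∈ Finset.Icc 1 T, 0 ≤ lam t)
    (hSmono : ∀ s t : ℕ, s ≤ t → t ≤ T → S s ⊆ S t)
    {i : Fin n} {s : ℕ} (hs : 1 ≤ s) (hi : i ∈ S s) :
    p i * ∑ τ ∈ Finset.Icc s T, lam τ ≤ Psi12 T lam p S := by
  have hsub : Finset.Icc s T ⊆ Finset.Icc 1 T := Finset.Icc_subset_Icc_left hs
  calc p i * ∑ τ ∈ Finset.Icc s T, lam τ = ∑ τ ∈ Finset.Icc s T, lam τ * p i := by
        rw [mul_comm, Finset.sum_mul]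
    _ ≤ ∑ τ ∈ Finset.Icc s T, lam τ * ∑ k ∈ S τ, p k := by
        refine Finset.sum_le_sum fun τ hτ => mul_le_mul_of_nonneg_left ?_ (hlam τ (hsub hτ))
        have hτ' := Finset.mem_Icc.mp hτ
        exact Finset.single_le_sum (fun k _ => hp k) (hSmono s τ hτ'.1 hτ'.2 hi)
    _ ≤ Psi12 T lam p S :=
        Finset.sum_le_sum_of_subset_of_nonneg hsub fun τ hτ _ =>
          mul_nonneg (hlam τ hτ) (Finset.sum_nonneg fun k _ => hp k)

/-- Let `C_1,…,C_M` be pairwise disjoint, time-ordered, well-separated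
clusters of periods (`λ^{t'+} ≤ (ε/n)·λ^{t+}` for `t ∈ C_m`, `t' ∈ C_{m'}`, `m < m'`, which is
equivalent to `λ^{(min C_{m'})+} ≤ (ε/n)·λ^{(max C_m)+}`).  If a solution `S` introduces items
only at cluster periods and every item contribution satisfies `Ψ_i(S) > (ε/n)·Ψ(S)`, then the
bipartite solution graph `G(S)` — with an edge `(C_m, P_ℓ)` whenever some item of profit class
`P_ℓ` is introduced at a period of `C_m` — is a collection of uncrossing stars:
(1) every class vertex has degree at most one, and (2) there are no crossing edges. -/
theorem stmt12
    (n T M : ℕ) (hn : 1 ≤ n) (hT : 1 ≤ T)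
    (ε : ℝ) (hε0 : 0 < ε) (hε1 : ε < 1)
    (p w : Fin n → ℝ) (hw : ∀ i, 0 < w i)
    (ℓfun : Fin n → ℕ) (hp : ∀ i, p i = (1 + ε) ^ ℓfun i)
    (Wcap lam : ℕ → ℝ)
    (hWmono : ∀ s t : ℕ, 1 ≤ s → s ≤ t → t ≤ T → Wcap s ≤ Wcap t)
    (hlam : ∀ t ∈ Finset.Icc 1 T, 0 ≤ lam t) (hlamT : 0 < lam T)
    -- the clusters
    (C : ℕ → Finset ℕ)
    (hCsub : ∀ m ∈ Finset.Icc 1 M, C m ⊆ Finset.Icc 1 T)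
    (hCdisj : ∀ m ∈ Finset.Icc 1 M, ∀ m' ∈ Finset.Icc 1 M, m ≠ m' → Disjoint (C m) (C m'))
    (hCord : ∀ m ∈ Finset.Icc 1 M, ∀ m' ∈ Finset.Icc 1 M, m < m' →
        ∀ t ∈ C m, ∀ t' ∈ C m', t < t')
    (hCsep : ∀ m ∈ Finset.Icc 1 M, ∀ m' ∈ Finset.Icc 1 M, m < m' →
        ∀ t ∈ C m, ∀ t' ∈ C m',
          ∑ τ ∈ Finset.Icc t' T, lam τ ≤ ε / n * ∑ τ ∈ Finset.Icc t T, lam τ)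
    -- the solution S with its introduction periods ν
    (S : ℕ → Finset (Fin n))
    (hS0 : S 0 = ∅)
    (hSmono : ∀ s t : ℕ, s ≤ t → t ≤ T → S s ⊆ S t)
    (hScap : ∀ t ∈ Finset.Icc 1 T, ∑ i ∈ S t, w i ≤ Wcap t)
    (ν : Fin n → ℕ)
    (hν : ∀ i ∈ S T, ν i ∈ Finset.Icc 1 T ∧ i ∈ S (ν i) ∧ i ∉ S (ν i - 1))
    -- items are introduced only at periods belonging to some cluster
    (hgood : ∀ t ∈ Finset.Icc 1 T, (∀ m ∈ Finset.Icc 1 M, t ∉ C m) → S t ⊆ S (t - 1))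
    -- every item contribution is non-negligible
    (hbig : ∀ i ∈ S T,
        ε / n * Psi12 T lam p S < p i * ∑ τ ∈ Finset.Icc (ν i) T, lam τ) :
    -- (1) every profit-class vertex has degree at most 1
    (∀ ℓ : ℕ, ∀ m1 ∈ Finset.Icc 1 M, ∀ m2 ∈ Finset.Icc 1 M,
        (∃ i ∈ S T, ℓfun i = ℓ ∧ ν i ∈ C m1) →
        (∃ i ∈ S T, ℓfun i = ℓ ∧ ν i ∈ C m2) → m1 = m2) ∧
      -- (2) no crossing edges
      (∀ m1 ∈ Finset.Icc 1 M, ∀ m2 ∈ Finset.Icc 1 M, ∀ ℓ1 ℓ2 : ℕ, ℓ1 < ℓ2 → m2 < m1 →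
        ¬((∃ i ∈ S T, ℓfun i = ℓ1 ∧ ν i ∈ C m1) ∧
          (∃ i ∈ S T, ℓfun i = ℓ2 ∧ ν i ∈ C m2))) := by
  have hp0 : ∀ i, 0 ≤ p i := fun i => by rw [hp]; positivity
  have key : ∀ m ∈ Finset.Icc 1 M, ∀ m' ∈ Finset.Icc 1 M, m < m' → ∀ i ∈ S T, ∀ j ∈ S T,
      ν i ∈ C m → ν j ∈ C m' → ℓfun i < ℓfun j := by
    intro m hm m' hm' hlt i hi j hj hiC hjC
    obtain ⟨hνi, hiS, -⟩ := hν i hi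
    obtain ⟨hνj, -, -⟩ := hν j hj
    have hle := item_contribution_le_Psi12 hp0 hlam hSmono (Finset.mem_Icc.mp hνi).1 hiS
    have hΛ : 0 ≤ ∑ τ ∈ Finset.Icc (ν j) T, lam τ := Finset.sum_nonneg fun τ hτ =>
      hlam τ (Finset.Icc_subset_Icc_left (Finset.mem_Icc.mp hνj).1 hτ)
    have hlt' : p i * ∑ τ ∈ Finset.Icc (ν j) T, lam τ
        < p j * ∑ τ ∈ Finset.Icc (ν j) T, lam τ :=
      calc p i * ∑ τ ∈ Finset.Icc (ν j) T, lam τ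
          ≤ p i * (ε / n * ∑ τ ∈ Finset.Icc (ν i) T, lam τ) :=
            mul_le_mul_of_nonneg_left (hCsep m hm m' hm' hlt _ hiC _ hjC) (hp0 i)
        _ = ε / n * (p i * ∑ τ ∈ Finset.Icc (ν i) T, lam τ) := by ring
        _ ≤ ε / n * Psi12 T lam p S := mul_le_mul_of_nonneg_left hle (by positivity)
        _ < _ := hbig j hj
    have hpij := lt_of_mul_lt_mul_right hlt' hΛ
    rw [hp i, hp j] at hpij
    exact (pow_lt_pow_iff_right₀ (by linarith)).mp hpij
  constructor
  · rintro ℓ m1 hm1 m2 hm2 ⟨i, hi, hiℓ, hiC⟩ ⟨j, hj, hjℓ, hjC⟩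
    rcases lt_trichotomy m1 m2 with h | h | h
    · have := key m1 hm1 m2 hm2 h i hi j hj hiC hjC
      omega
    · exact h
    · have := key m2 hm2 m1 hm1 h j hj i hi hjC hiC
      omega
  · rintro m1 hm1 m2 hm2 ℓ1 ℓ2 hℓ hm ⟨⟨i, hi, hiℓ, hiC⟩, j, hj, hjℓ, hjC⟩
    have := key m2 hm2 m1 hm1 hm j hj i hi hjC hiC
    omega
end
end

section
/- Fix ε ∈ (0, 1/2) with 1/ε ∈ ℕ. For t ∈ [T], let m(t) ≥ 1 be the unique positive integer with λ^{t+} ∈ ((ε/n)^{m(t)} · λ^{1+}, (ε/n)^{m(t)−1} · λ^{1+}], and for ξ ∈ {0, …, 1/ε − 1} call period t bad for ξ if m(t) ≡ ξ (mod 1/ε) and good for ξ otherwise. Let S* be an optimal solution (one maximizing Ψ over all solutions). Then there exist ξ ∈ {0, …, 1/ε − 1} and a feasible solution S such that: (i) S introduces items only at periods that are good for ξ; (ii) Ψ_i(S) > (ε/n)·Ψ(S) for every i ∈ S_T; and (iii) Ψ(S) ≥ (1 − 2ε)·Ψ(S*). -/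
open Finset

noncomputable section

/-- The profit `Ψ(S) = Σ_{t∈[T]} λ_t · p(S_t)` of a sequence of item sets. -/
def Psi13 {n : ℕ} (T : ℕ) (lam : ℕ → ℝ) (p : Fin n → ℝ) (S : ℕ → Finset (Fin n)) : ℝ :=
  ∑ t ∈ Finset.Icc 1 T, lam t * ∑ i ∈ S t, p i

/-- The profit of a nested sequence, summed item by item, where item `i ∈ S T` is present exactly
from period `ν i` on. -/
theorem Psi13_eq_sum_items {n T : ℕ} (lam : ℕ → ℝ) (p : Fin n → ℝ) (S : ℕ → Finset (Fin n))
    (ν : Fin n → ℕ) (hν : ∀ i ∈ S T, 1 ≤ ν i)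
    (hmono : ∀ t ≤ T, S t ⊆ S T)
    (hmem : ∀ i ∈ S T, ∀ t ≤ T, i ∈ S t ↔ ν i ≤ t) :
    Psi13 T lam p S = ∑ i ∈ S T, p i * ∑ τ ∈ Finset.Icc (ν i) T, lam τ := by
  unfold Psi13
  simp_rw [Finset.mul_sum, mul_comm (p _)]
  apply Finset.sum_comm'
  intro t i
  simp only [Finset.mem_Icc]
  constructor
  · rintro ⟨⟨_, htT⟩, hi⟩
    have hiT := hmono t htT hi
    exact ⟨⟨(hmem i hiT t htT).1 hi, htT⟩, hiT⟩
  · rintro ⟨⟨hνt, htT⟩, hiT⟩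
    exact ⟨⟨(hν i hiT).trans hνt, htT⟩, (hmem i hiT t htT).2 hνt⟩

/-- Among the `e` residue classes modulo `e`, one carries at most the average of a sum. -/
theorem exists_residue_sum_le_average {ι : Type*} (s : Finset ι) (c : ι → ℝ) (f : ι → ℕ)
    {e : ℕ} {ε : ℝ} (he : (e : ℝ) * ε = 1) :
    ∃ ξ < e, ∑ i ∈ s with f i % e = ξ, c i ≤ ε * ∑ i ∈ s, c i := by
  have hpos : 0 < e := by
    rcases Nat.eq_zero_or_pos e with rfl | h
    · simp at he
    · exact h
  have hfiber : ∑ ξ ∈ Finset.range e, ∑ i ∈ s with f i % e = ξ, c i = ∑ i ∈ s, c i :=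
    Finset.sum_fiberwise_of_maps_to (fun i _ => Finset.mem_range.2 (Nat.mod_lt _ hpos)) c
  obtain ⟨ξ, hξ, hle⟩ := Finset.exists_le_of_sum_le (s := Finset.range e)
    (f := fun ξ => ∑ i ∈ s with f i % e = ξ, c i) (g := fun _ => ε * ∑ i ∈ s, c i)
    ⟨0, Finset.mem_range.2 hpos⟩ (by
      rw [hfiber, Finset.sum_const, Finset.card_range, nsmul_eq_mul, ← mul_assoc, he, one_mul])
  exact ⟨ξ, Finset.mem_range.1 hξ, hle⟩

/-- With `m(t)` the unique positive integer such that
`λ^{t+} ∈ ((ε/n)^{m(t)}·λ^{1+}, (ε/n)^{m(t)−1}·λ^{1+}]`, and a period `t` bad for `ξ` if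
`m(t) ≡ ξ (mod 1/ε)`: for any optimal solution `S*` there exist `ξ ∈ {0,…,1/ε−1}` and a
feasible solution `S` (with introduction periods `ν`) such that (i) `S` introduces items only
at periods that are good for `ξ`, (ii) `Ψ_i(S) > (ε/n)·Ψ(S)` for every `i ∈ S_T`, and
(iii) `Ψ(S) ≥ (1−2ε)·Ψ(S*)`. -/
theorem stmt13
    (n T : ℕ) (hn : 1 ≤ n) (hT : 1 ≤ T)
    (ε : ℝ) (e : ℕ) (hε0 : 0 < ε) (hε1 : ε < 1 / 2) (he : (e : ℝ) * ε = 1)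
    (p w : Fin n → ℝ) (hp : ∀ i, 0 < p i) (hw : ∀ i, 0 < w i)
    (Wcap lam : ℕ → ℝ)
    (hWmono : ∀ s t : ℕ, 1 ≤ s → s ≤ t → t ≤ T → Wcap s ≤ Wcap t)
    (hlam : ∀ t ∈ Finset.Icc 1 T, 0 ≤ lam t) (hlamT : 0 < lam T)
    -- the interval index m(t)
    (m : ℕ → ℕ)
    (hm : ∀ t ∈ Finset.Icc 1 T, 1 ≤ m t ∧
        (ε / n) ^ m t * (∑ τ ∈ Finset.Icc 1 T, lam τ) < ∑ τ ∈ Finset.Icc t T, lam τ ∧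
        ∑ τ ∈ Finset.Icc t T, lam τ ≤ (ε / n) ^ (m t - 1) * (∑ τ ∈ Finset.Icc 1 T, lam τ))
    -- an optimal solution S*
    (Sstar : ℕ → Finset (Fin n))
    (hS0 : Sstar 0 = ∅)
    (hSmono : ∀ s t : ℕ, s ≤ t → t ≤ T → Sstar s ⊆ Sstar t)
    (hScap : ∀ t ∈ Finset.Icc 1 T, ∑ i ∈ Sstar t, w i ≤ Wcap t)
    (hopt : ∀ S : ℕ → Finset (Fin n), S 0 = ∅ →
        (∀ s t : ℕ, s ≤ t → t ≤ T → S s ⊆ S t) →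
        (∀ t ∈ Finset.Icc 1 T, ∑ i ∈ S t, w i ≤ Wcap t) →
        Psi13 T lam p S ≤ Psi13 T lam p Sstar) :
    ∃ ξ : ℕ, ξ < e ∧
      ∃ S : ℕ → Finset (Fin n), ∃ ν : Fin n → ℕ,
        S 0 = ∅ ∧
        (∀ s t : ℕ, s ≤ t → t ≤ T → S s ⊆ S t) ∧
        (∀ t ∈ Finset.Icc 1 T, ∑ i ∈ S t, w i ≤ Wcap t) ∧
        (∀ i ∈ S T, ν i ∈ Finset.Icc 1 T ∧ i ∈ S (ν i) ∧ i ∉ S (ν i - 1)) ∧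
        -- (i) nothing is introduced at periods that are bad for ξ
        (∀ t ∈ Finset.Icc 1 T, m t % e = ξ → S t ⊆ S (t - 1)) ∧
        -- (ii) every item contribution is non-negligible
        (∀ i ∈ S T,
            ε / n * Psi13 T lam p S < p i * ∑ τ ∈ Finset.Icc (ν i) T, lam τ) ∧
        -- (iii) near-optimality
        (1 - 2 * ε) * Psi13 T lam p Sstar ≤ Psi13 T lam p S := by
  classical
  set ν : Fin n → ℕ := fun i => sInf {t | i ∈ Sstar t} with hνdef
  have hνmem : ∀ i ∈ Sstar T, i ∈ Sstar (ν i) := fun i hi =>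
    Nat.sInf_mem (s := {t | i ∈ Sstar t}) ⟨T, hi⟩
  have hνle : ∀ i t, i ∈ Sstar t → ν i ≤ t := fun i t hi =>
    Nat.sInf_le (s := {t | i ∈ Sstar t}) hi
  have hνpos : ∀ i ∈ Sstar T, 1 ≤ ν i := by
    intro i hi
    by_contra! h
    have := hνmem i hi
    rw [Nat.lt_one_iff.1 h, hS0] at this
    simp at this
  have hνpred : ∀ i ∈ Sstar T, i ∉ Sstar (ν i - 1) := by
    intro i hi h
    have := hνle i _ h
    have := hνpos i hi
    omega
  have hmem : ∀ i ∈ Sstar T, ∀ t ≤ T, i ∈ Sstar t ↔ ν i ≤ t := fun i hi t ht =>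
    ⟨hνle i t, fun h => hSmono _ _ h ht (hνmem i hi)⟩
  set c : Fin n → ℝ := fun i => p i * ∑ τ ∈ Finset.Icc (ν i) T, lam τ with hc
  have hc0 : ∀ i ∈ Sstar T, 0 ≤ c i := fun i hi =>
    mul_nonneg (hp i).le (Finset.sum_nonneg fun τ hτ => hlam τ (Finset.mem_Icc.2
      ⟨(hνpos i hi).trans (Finset.mem_Icc.1 hτ).1, (Finset.mem_Icc.1 hτ).2⟩))
  have hPstar : Psi13 T lam p Sstar = ∑ i ∈ Sstar T, c i :=
    Psi13_eq_sum_items lam p Sstar ν hνpos (fun t ht => hSmono t T ht le_rfl) hmem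
  set P := Psi13 T lam p Sstar with hP
  obtain ⟨ξ, hξ, hbad⟩ := exists_residue_sum_le_average (Sstar T) c (fun i => m (ν i)) he
  rw [← hPstar] at hbad
  have hPnonneg : 0 ≤ P := hPstar ▸ Finset.sum_nonneg hc0
  have hn0 : (0 : ℝ) < n := by exact_mod_cast hn
  have hεn : 0 ≤ ε / n := (div_pos hε0 hn0).le
  set K : Fin n → Prop := fun i => m (ν i) % e ≠ ξ ∧ ε / n * P < c i with hK
  set S : ℕ → Finset (Fin n) := fun t => (Sstar t).filter K with hS
  have hPS : Psi13 T lam p S = ∑ i ∈ S T, c i := by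
    refine Psi13_eq_sum_items lam p S ν (fun i hi => hνpos i (Finset.mem_filter.1 hi).1)
      (fun t ht => Finset.filter_subset_filter K (hSmono t T ht le_rfl)) fun i hi t ht => ?_
    obtain ⟨hi, hKi⟩ := Finset.mem_filter.1 hi
    simp [hS, hKi, hmem i hi t ht]
  have hPSle : Psi13 T lam p S ≤ P := by
    rw [hPS, hPstar]
    exact Finset.sum_le_sum_of_subset_of_nonneg (Finset.filter_subset _ _)
      fun i hi _ => hc0 i hi
  have hsmall : ∑ i ∈ Sstar T with c i ≤ ε / n * P, c i ≤ ε * P := by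
    calc ∑ i ∈ Sstar T with c i ≤ ε / n * P, c i
        ≤ #{i ∈ Sstar T | c i ≤ ε / n * P} • (ε / n * P) :=
          Finset.sum_le_card_nsmul _ _ _ fun i hi => (Finset.mem_filter.1 hi).2
      _ ≤ n * (ε / n * P) := by
          rw [nsmul_eq_mul]
          gcongr
          simpa using Finset.card_le_univ {i ∈ Sstar T | c i ≤ ε / n * P}
      _ = ε * P := by field_simp
  have hremoved : ∑ i ∈ Sstar T with ¬ K i, c i ≤ 2 * ε * P := by
    have hle : ∑ i ∈ Sstar T with ¬ K i, c i ≤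
        ∑ i ∈ Sstar T with m (ν i) % e = ξ, c i + ∑ i ∈ Sstar T with c i ≤ ε / n * P, c i := by
      rw [Finset.sum_filter, Finset.sum_filter, Finset.sum_filter, ← Finset.sum_add_distrib]
      refine Finset.sum_le_sum fun i hi => ?_
      have := hc0 i hi
      by_cases h1 : m (ν i) % e = ξ <;> by_cases h2 : c i ≤ ε / n * P <;>
        simp [hK, h1, h2, not_le.1, this]
    linarith
  have hsplit := Finset.sum_filter_add_sum_filter_not (Sstar T) K c
  refine ⟨ξ, hξ, S, ν, by simp [hS, hS0],
    fun s t hst ht => Finset.filter_subset_filter K (hSmono s t hst ht),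
    fun t ht => (Finset.sum_le_sum_of_subset_of_nonneg (Finset.filter_subset _ _)
      fun i _ _ => (hw i).le).trans (hScap t ht), ?_, ?_, ?_, ?_⟩
  · intro i hi
    obtain ⟨hi, hKi⟩ := Finset.mem_filter.1 hi
    exact ⟨Finset.mem_Icc.2 ⟨hνpos i hi, hνle i T hi⟩,
      Finset.mem_filter.2 ⟨hνmem i hi, hKi⟩,
      fun h => hνpred i hi (Finset.mem_filter.1 h).1⟩
  · intro t ht hmt i hi
    obtain ⟨hit, hKi⟩ := Finset.mem_filter.1 hi
    have htT := (Finset.mem_Icc.1 ht).2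
    have hiT := hSmono t T htT le_rfl hit
    have hne : ν i ≠ t := fun h => hKi.1 (h ▸ hmt)
    have hlt := lt_of_le_of_ne (hνle i t hit) hne
    exact Finset.mem_filter.2 ⟨(hmem i hiT (t - 1) (by omega)).2 (by omega), hKi⟩
  · intro i hi
    exact (mul_le_mul_of_nonneg_left hPSle hεn).trans_lt (Finset.mem_filter.1 hi).2.2
  · change ∑ i ∈ S T, c i + _ = _ at hsplit
    rw [hPS]
    linarith
end
end

section
/- Let S be a solution and ε ∈ (0,1). Let S' be the sequence obtained from S by deleting, from every set S_t, all items i ∈ S_T with Ψ_i(S) ≤ (ε/n)·Ψ(S), while every remaining item keeps its introduction period. Then S' is a feasible solution, Ψ_i(S') = Ψ_i(S) for every remaining item i, and Ψ(S') ≥ (1 − ε)·Ψ(S). -/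
open Finset
open scoped Classical

noncomputable section

/-- The profit `Ψ(S) = Σ_{t∈[T]} λ_t · p(S_t)` of a sequence of item sets. -/
def Psi14 {n : ℕ} (T : ℕ) (lam : ℕ → ℝ) (p : Fin n → ℝ) (S : ℕ → Finset (Fin n)) : ℝ :=
  ∑ t ∈ Finset.Icc 1 T, lam t * ∑ i ∈ S t, p i

/-- In a nested sequence, an item of `S T` belongs to `S t` exactly from its introduction period
on. -/
theorem mem_iff_introduction_le {n T : ℕ} {S : ℕ → Finset (Fin n)}
    (hSmono : ∀ s t : ℕ, s ≤ t → t ≤ T → S s ⊆ S t) {i : Fin n} {k t : ℕ}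
    (hmem : i ∈ S k) (hnot : i ∉ S (k - 1)) (hkT : k ≤ T) (htT : t ≤ T) :
    i ∈ S t ↔ k ≤ t := by
  refine ⟨fun h => ?_, fun h => hSmono k t h htT hmem⟩
  by_contra! hlt
  exact hnot (hSmono t (k - 1) (by omega) (by omega) h)

/-- The profit of a nested sequence is the sum of the contributions of its items. -/
theorem Psi14_eq_sum_contributions {n T : ℕ} (lam : ℕ → ℝ) (p : Fin n → ℝ)
    {S : ℕ → Finset (Fin n)} (hSmono : ∀ s t : ℕ, s ≤ t → t ≤ T → S s ⊆ S t) {ν : Fin n → ℕ}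
    (hν : ∀ i ∈ S T, ν i ∈ Finset.Icc 1 T ∧ i ∈ S (ν i) ∧ i ∉ S (ν i - 1)) :
    Psi14 T lam p S = ∑ i ∈ S T, p i * ∑ τ ∈ Finset.Icc (ν i) T, lam τ := by
  unfold Psi14
  simp_rw [Finset.mul_sum, mul_comm (p _)]
  refine Finset.sum_comm' (fun t i => ?_)
  constructor
  · rintro ⟨ht, hi⟩
    have htT := (Finset.mem_Icc.1 ht).2
    have hiT := hSmono t T htT le_rfl hi
    obtain ⟨hνi, hmem, hnot⟩ := hν i hiT
    exact ⟨Finset.mem_Icc.2 ⟨(mem_iff_introduction_le hSmono hmem hnot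
      (Finset.mem_Icc.1 hνi).2 htT).1 hi, htT⟩, hiT⟩
  · rintro ⟨ht, hiT⟩
    obtain ⟨hνi, hmem, -⟩ := hν i hiT
    rw [Finset.mem_Icc] at ht hνi
    exact ⟨Finset.mem_Icc.2 ⟨hνi.1.trans ht.1, ht.2⟩, hSmono _ t ht.1 ht.2 hmem⟩

/-- Deleting from `s ⊆ Fin n` all elements of value at most `c / n` loses at most `c`. -/
theorem sum_sub_le_sum_filter_not_le {n : ℕ} (hn : 1 ≤ n) (s : Finset (Fin n)) (f : Fin n → ℝ)
    {c : ℝ} (hc : 0 ≤ c) :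
    ∑ i ∈ s, f i - c ≤ ∑ i ∈ s.filter fun i => ¬ f i ≤ c / n, f i := by
  have hsplit := Finset.sum_filter_add_sum_filter_not s (fun i => f i ≤ c / n) f
  have hsmall : ∑ i ∈ s.filter fun i => f i ≤ c / n, f i ≤ c := by
    have hcard : ((s.filter fun i => f i ≤ c / n).card : ℝ) ≤ n := by
      exact_mod_cast (Finset.card_le_univ _).trans_eq (Fintype.card_fin n)
    have hn0 : (n : ℝ) ≠ 0 := by positivity
    calc ∑ i ∈ s.filter fun i => f i ≤ c / n, f i
        ≤ (s.filter fun i => f i ≤ c / n).card • (c / n) :=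
          Finset.sum_le_card_nsmul _ _ _ fun i hi => (Finset.mem_filter.1 hi).2
      _ ≤ n * (c / n) := by
          rw [nsmul_eq_mul]
          gcongr
      _ = c := mul_div_cancel₀ c hn0
  linarith

/-- Filtering items with negligible contribution.  Let `S` be a solution
(with introduction periods `ν`) and `ε ∈ (0,1)`, and let `S'` be obtained from `S` by deleting
from every set `S_t` all items `i ∈ S_T` with `Ψ_i(S) ≤ (ε/n)·Ψ(S)`, every remaining item
keeping its introduction period.  Then `S'` is a feasible solution, `Ψ_i(S') = Ψ_i(S)` for
every remaining item `i` (its introduction period in `S'` is still `ν i`), and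
`Ψ(S') ≥ (1−ε)·Ψ(S)`. -/
theorem stmt14
    (n T : ℕ) (hn : 1 ≤ n) (hT : 1 ≤ T)
    (ε : ℝ) (hε0 : 0 < ε) (hε1 : ε < 1)
    (p w : Fin n → ℝ) (hp : ∀ i, 0 < p i) (hw : ∀ i, 0 < w i)
    (Wcap lam : ℕ → ℝ)
    (hWmono : ∀ s t : ℕ, 1 ≤ s → s ≤ t → t ≤ T → Wcap s ≤ Wcap t)
    (hlam : ∀ t ∈ Finset.Icc 1 T, 0 ≤ lam t) (hlamT : 0 < lam T)
    (S : ℕ → Finset (Fin n))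
    (hS0 : S 0 = ∅)
    (hSmono : ∀ s t : ℕ, s ≤ t → t ≤ T → S s ⊆ S t)
    (hScap : ∀ t ∈ Finset.Icc 1 T, ∑ i ∈ S t, w i ≤ Wcap t)
    (ν : Fin n → ℕ)
    (hν : ∀ i ∈ S T, ν i ∈ Finset.Icc 1 T ∧ i ∈ S (ν i) ∧ i ∉ S (ν i - 1))
    (S' : ℕ → Finset (Fin n))
    (hS' : ∀ t, S' t = (S t).filter fun i =>
        ¬ p i * (∑ τ ∈ Finset.Icc (ν i) T, lam τ) ≤ ε / n * Psi14 T lam p S) :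
    (S' 0 = ∅ ∧
      (∀ s t : ℕ, s ≤ t → t ≤ T → S' s ⊆ S' t) ∧
      (∀ t ∈ Finset.Icc 1 T, ∑ i ∈ S' t, w i ≤ Wcap t)) ∧
    -- every remaining item keeps its introduction period, hence Ψ_i(S') = Ψ_i(S)
    (∀ i ∈ S' T, i ∈ S' (ν i) ∧ i ∉ S' (ν i - 1)) ∧
    (1 - ε) * Psi14 T lam p S ≤ Psi14 T lam p S' := by
  have hS'mono : ∀ s t : ℕ, s ≤ t → t ≤ T → S' s ⊆ S' t := fun s t hst htT => by
    rw [hS' s, hS' t]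
    exact Finset.filter_subset_filter _ (hSmono s t hst htT)
  have hsub : ∀ t, S' t ⊆ S t := fun t => by
    rw [hS' t]
    exact Finset.filter_subset _ _
  have hν' : ∀ i ∈ S' T, ν i ∈ Finset.Icc 1 T ∧ i ∈ S' (ν i) ∧ i ∉ S' (ν i - 1) := fun i hi => by
    obtain ⟨hνi, hmem, hnot⟩ := hν i (hsub T hi)
    refine ⟨hνi, ?_, fun h => hnot (hsub _ h)⟩
    rw [hS', Finset.mem_filter] at hi ⊢
    exact ⟨hmem, hi.2⟩
  refine ⟨⟨?_, hS'mono, fun t ht => ?_⟩, fun i hi => (hν' i hi).2, ?_⟩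
  · exact Finset.subset_empty.1 (hS0 ▸ hsub 0)
  · exact (Finset.sum_le_sum_of_subset_of_nonneg (hsub t) fun i _ _ => (hw i).le).trans
      (hScap t ht)
  · have hΨ : 0 ≤ Psi14 T lam p S := Finset.sum_nonneg fun t ht =>
      mul_nonneg (hlam t ht) (Finset.sum_nonneg fun i _ => (hp i).le)
    have hloss := sum_sub_le_sum_filter_not_le hn (S T)
      (fun i => p i * ∑ τ ∈ Finset.Icc (ν i) T, lam τ) (mul_nonneg hε0.le hΨ)
    rw [← Psi14_eq_sum_contributions lam p hSmono hν, mul_div_right_comm, ← hS' T,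
      ← Psi14_eq_sum_contributions lam p hS'mono hν'] at hloss
    linarith
end
end
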